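/- Exactness of the McCormick envelope for a bilinear term over a rectangle: for every K > 0, the set S = {(λ, γ, w) ∈ ℝ³ : 0 ≤ λ ≤ 1, −K ≤ γ ≤ K, w ≥ −λK, w ≥ γ + λK − K, w ≤ γ − λK + K, w ≤ λK} equals the convex hull (over ℝ) of the graph G = {(λ, γ, λγ) : λ ∈ [0,1], γ ∈ [−K, K]}. -/

import Mathlib

/-- A number of absolute value at most `t * K` is `t` times a number in `[-K, K]`. -/
theorem exists_mem_Icc_mul_eq {t K x : ℝ} (hK : 0 ≤ K) (ht : 0 ≤ t)
    (hl : -(t * K) ≤ x) (hu : x ≤ t * K) : ∃ b ∈ Set.Icc (-K) K, t * b = x := by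
  rcases ht.eq_or_lt with rfl | ht
  · exact ⟨0, ⟨by linarith, hK⟩, by linarith⟩
  · refine ⟨x / t, ⟨?_, ?_⟩, by field_simp⟩
    · rw [le_div_iff₀ ht]; linarith
    · rw [div_le_iff₀ ht]; linarith

/-- exactness of the McCormick envelope for a bilinear term over the rectangle
`[0,1] × [−K,K]`: the McCormick polytope equals the convex hull of the graph of the product. -/
theorem mccormick_exact (K : ℝ) (hK : 0 < K) :
    { q : ℝ × ℝ × ℝ | 0 ≤ q.1 ∧ q.1 ≤ 1 ∧ -K ≤ q.2.1 ∧ q.2.1 ≤ K ∧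
        q.2.2 ≥ -(q.1 * K) ∧ q.2.2 ≥ q.2.1 + q.1 * K - K ∧
        q.2.2 ≤ q.2.1 - q.1 * K + K ∧ q.2.2 ≤ q.1 * K }
      = convexHull ℝ
          ((fun r : ℝ × ℝ => (r.1, r.2, r.1 * r.2)) ''
            (Set.Icc (0 : ℝ) 1 ×ˢ Set.Icc (-K) K)) := by
  apply Set.Subset.antisymm
  · rintro ⟨l, g, w⟩ ⟨h0, h1, -, -, h2, h3, h4, h5⟩
    dsimp only at h0 h1 h2 h3 h4 h5
    obtain ⟨b, hb, hbw⟩ := exists_mem_Icc_mul_eq hK.le h0 h2 h5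
    obtain ⟨a, ha, hag⟩ := exists_mem_Icc_mul_eq (x := g - w) hK.le (sub_nonneg.2 h1)
      (by linarith) (by linarith)
    have hmem : ∀ t ∈ Set.Icc (0 : ℝ) 1, ∀ c ∈ Set.Icc (-K) K,
        (t, c, t * c) ∈ convexHull ℝ ((fun r : ℝ × ℝ => (r.1, r.2, r.1 * r.2)) ''
          (Set.Icc (0 : ℝ) 1 ×ˢ Set.Icc (-K) K)) :=
      fun t ht c hc => subset_convexHull ℝ _ ⟨(t, c), ⟨ht, hc⟩, rfl⟩
    convert convex_convexHull ℝ _ (hmem 0 (by simp) a ha) (hmem 1 (by simp) b hb)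
      (sub_nonneg.2 h1) h0 (sub_add_cancel 1 l) using 1
    ext <;> simp <;> linarith
  · refine convexHull_min ?_ ?_
    · rintro _ ⟨⟨l, g⟩, ⟨⟨h0, h1⟩, h2, h3⟩, rfl⟩
      dsimp only at h0 h1 h2 h3
      refine ⟨h0, h1, h2, h3, ?_, ?_, ?_, ?_⟩ <;> dsimp only <;> nlinarith
    · rintro ⟨l, g, w⟩ ⟨h1, h2, h3, h4, h5, h6, h7, h8⟩ ⟨l', g', w'⟩
        ⟨k1, k2, k3, k4, k5, k6, k7, k8⟩ s t hs ht hst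
      obtain rfl : s = 1 - t := by linarith
      dsimp only at *
      refine ⟨?_, ?_, ?_, ?_, ?_, ?_, ?_, ?_⟩ <;>
        simp only [Prod.smul_mk, Prod.mk_add_mk, smul_eq_mul]
      · linarith [mul_le_mul_of_nonneg_left h1 hs, mul_le_mul_of_nonneg_left k1 ht]
      · linarith [mul_le_mul_of_nonneg_left h2 hs, mul_le_mul_of_nonneg_left k2 ht]
      · linarith [mul_le_mul_of_nonneg_left h3 hs, mul_le_mul_of_nonneg_left k3 ht]
      · linarith [mul_le_mul_of_nonneg_left h4 hs, mul_le_mul_of_nonneg_left k4 ht]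
      · linarith [mul_le_mul_of_nonneg_left h5 hs, mul_le_mul_of_nonneg_left k5 ht]
      · linarith [mul_le_mul_of_nonneg_left h6 hs, mul_le_mul_of_nonneg_left k6 ht]
      · linarith [mul_le_mul_of_nonneg_left h7 hs, mul_le_mul_of_nonneg_left k7 ht]
      · linarith [mul_le_mul_of_nonneg_left h8 hs, mul_le_mul_of_nonneg_left k8 ht]
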